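/- arXiv:1107.1296 — 8 statements merged into one kernel-verified Lean document; each statement's English description precedes it below -/
import Mathlib

section
/- For any nonempty family F of subsets of [n] = {1,...,n} with ∅ ∉ F, the AZ identity holds: ∑_{X ∈ U_n(F)} |Z_F(X)| / (|X| · binomial(n, |X|)) = 1, where the sum is over all sets X in the upset of F. -/
open Finset

def upSet (n : ℕ) (F : Finset (Finset (Fin n))) : Finset (Finset (Fin n)) :=
  univ.filter (fun X => ∃ A ∈ F, A ⊆ X)

def downSet (n : ℕ) (F : Finset (Finset (Fin n))) : Finset (Finset (Fin n)) :=
  univ.filter (fun X => ∃ A ∈ F, X ⊆ A)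

def zSet (n : ℕ) (F : Finset (Finset (Fin n))) (X : Finset (Fin n)) : Finset (Fin n) :=
  if X ∈ upSet n F then (F.filter (fun A => A ⊆ X)).inf id else ∅

def joinFam (n : ℕ) (F G : Finset (Finset (Fin n))) : Finset (Finset (Fin n)) :=
  (F ×ˢ G).image (fun p => p.1 ∪ p.2)

noncomputable def g (a m : ℝ) (n l : ℕ) : ℝ :=
  (Nat.factorial (n - l) : ℝ) * a ^ (n - l) / ∏ k ∈ Finset.Icc l n, (a * k + m)

lemma mem_upSet_iff_mem_upperClosure {n : ℕ} {F : Finset (Finset (Fin n))} {X : Finset (Fin n)} :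
    X ∈ upSet n F ↔ X ∈ upperClosure (F : Set (Finset (Fin n))) := by
  simp [upSet]

lemma zSet_eq_truncatedInf (n : ℕ) (F : Finset (Finset (Fin n))) (X : Finset (Fin n)) :
    zSet n F X = truncatedInf F X := by
  by_cases hX : X ∈ upSet n F
  · rw [zSet, if_pos hX, truncatedInf_of_mem (mem_upSet_iff_mem_upperClosure.1 hX),
      inf'_eq_inf]
  · rw [zSet, if_neg hX, truncatedInf_of_notMem (mt mem_upSet_iff_mem_upperClosure.2 hX),
      bot_eq_empty]

/-- The AZ identity (Ahlswede–Zhang). -/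
theorem az_identity (n : ℕ) (F : Finset (Finset (Fin n)))
    (hF : F.Nonempty) (hne : ∅ ∉ F) :
    ∑ X ∈ upSet n F,
      ((zSet n F X).card : ℝ) / (X.card * (Nat.choose n X.card)) = 1 := by
  have hn : Nonempty (Fin n) := by
    obtain ⟨A, hA⟩ := hF
    obtain ⟨x, -⟩ := nonempty_iff_ne_empty.2 (ne_of_mem_of_not_mem hA hne)
    exact ⟨x⟩
  have h := AhlswedeZhang.infSum_eq_one hF hne
  rw [AhlswedeZhang.infSum, ← sum_subset (subset_univ (upSet n F)), Fintype.card_fin] at h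
  · simp only [zSet_eq_truncatedInf]
    have h_real := congrArg (Rat.cast : ℚ → ℝ) h
    push_cast at h_real
    exact h_real
  · intro X _ hX
    rw [truncatedInf_of_notMem (mt mem_upSet_iff_mem_upperClosure.2 hX)]
    simp
end

section
/- Let A = {A_1, ..., A_q} and B = {B_1, ..., B_q} be families of subsets of [n] = {1,...,n} such that A_i ≠ ∅ for all i, and A_j ⊆ B_k if and only if j = k. Then ∑_{i=1}^q 1 / binomial(n − |B_i| + |A_i|, |A_i|) + ∑_{X ∈ U_n(A) \ D_n(B)} |Z_A(X)| / (|X| · binomial(n, |X|)) = 1. -/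
open Finset

/-- The proportion of maximal chains of subsets of an `n`-element set that use a given covering
pair whose larger member has `m` elements. -/
noncomputable def coverWeight (n m : ℕ) : ℝ :=
  ((m - 1).factorial * (n - m).factorial : ℝ) / n.factorial

theorem one_div_mul_choose_eq_coverWeight {n m : ℕ} (hm : 0 < m) (hmn : m ≤ n) :
    1 / ((m : ℝ) * n.choose m) = coverWeight n m := by
  obtain ⟨k, rfl⟩ := Nat.exists_eq_succ_of_ne_zero hm.ne'
  rw [coverWeight, Nat.cast_choose ℝ hmn, Nat.succ_sub_one, Nat.factorial_succ]
  have h₁ := Nat.factorial_ne_zero k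
  have h₂ := Nat.factorial_ne_zero n
  have h₃ := Nat.factorial_ne_zero (n - (k + 1))
  push_cast
  field_simp

theorem card_mul_coverWeight_eq {n m : ℕ} (hm : 0 < m) (hmn : m < n) :
    (m : ℝ) * coverWeight n m = ((n - m : ℕ) : ℝ) * coverWeight n (m + 1) := by
  obtain ⟨k, rfl⟩ := Nat.exists_eq_succ_of_ne_zero hm.ne'
  obtain ⟨d, rfl⟩ := Nat.exists_eq_add_of_lt hmn
  have h₁ : k + 1 + d + 1 - (k + 1) = d + 1 := by omega
  have h₂ : k + 1 + d + 1 - (k + 1 + 1) = d := by omega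
  simp only [coverWeight, Nat.succ_eq_add_one, h₁, h₂, Nat.add_sub_cancel,
    Nat.factorial_succ k, Nat.factorial_succ d]
  push_cast
  ring

theorem sum_powerset_coverWeight {α : Type*} [DecidableEq α] (n : ℕ) (D : Finset α) :
    ∀ a : ℕ, 0 < a → a + D.card ≤ n →
      ∑ T ∈ D.powerset, coverWeight n (a + T.card) = coverWeight (n - D.card) a := by
  induction D using Finset.induction_on with
  | empty => simp
  | insert x D hx ih =>
    intro a ha h
    rw [card_insert_of_notMem hx] at h ⊢
    have h_insert : ∑ T ∈ D.powerset, coverWeight n (a + (insert x T).card)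
        = ∑ T ∈ D.powerset, coverWeight n (a + 1 + T.card) := by
      refine sum_congr rfl fun T hT => ?_
      rw [card_insert_of_notMem fun hxT => hx (mem_powerset.1 hT hxT), add_right_comm, add_assoc]
    rw [sum_powerset_insert hx, h_insert, ih a ha (by omega), ih (a + 1) (by omega) (by omega)]
    obtain ⟨k, rfl⟩ := Nat.exists_eq_succ_of_ne_zero ha.ne'
    obtain ⟨d, rfl⟩ := Nat.exists_eq_add_of_le h
    have h₁ : k.succ + (D.card + 1) + d - D.card = k + d + 1 + 1 := by omega
    have h₂ : k.succ + (D.card + 1) + d - (D.card + 1) = k + d + 1 := by omega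
    have h₃ : k + d + 1 + 1 - (k + 1) = d + 1 := by omega
    have h₄ : k + d + 1 + 1 - (k + 1 + 1) = d := by omega
    have h₅ : k + d + 1 - (k + 1) = d := by omega
    simp only [h₁, h₂, coverWeight, Nat.succ_eq_add_one, h₃, h₄, h₅, Nat.add_sub_cancel,
      Nat.factorial_succ (k + d + 1), Nat.factorial_succ k, Nat.factorial_succ d]
    have := Nat.factorial_ne_zero (k + d + 1)
    push_cast
    field_simp
    ring

theorem sum_Icc_card_mul_coverWeight {n : ℕ} {A B : Finset (Fin n)} (hA : A.Nonempty)
    (hAB : A ⊆ B) :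
    ∑ X ∈ Icc A B, (A.card : ℝ) * coverWeight n X.card
      = 1 / ((n - B.card + A.card).choose A.card : ℝ) := by
  have h_card : (B \ A).card = B.card - A.card := card_sdiff_of_subset hAB
  have h_le := card_le_card hAB
  have h_n : B.card ≤ n := by simpa using card_le_univ B
  have h_pos := hA.card_pos
  have h_sum : ∑ X ∈ Icc A B, coverWeight n X.card
      = ∑ T ∈ (B \ A).powerset, coverWeight n (A.card + T.card) := by
    have h_disj : ∀ T ∈ (B \ A).powerset, Disjoint A T := fun T hT =>
      disjoint_of_subset_right (mem_powerset.1 hT) disjoint_sdiff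
    rw [Icc_eq_image_powerset hAB, sum_image]
    · exact sum_congr rfl fun T hT => by rw [card_union_of_disjoint (h_disj T hT)]
    · intro S hS T hT h
      have h' : A ∪ S = A ∪ T := h
      rw [← (h_disj S hS).sdiff_eq_right, ← (h_disj T hT).sdiff_eq_right,
        ← union_sdiff_left, ← union_sdiff_left A T, h']
  rw [← mul_sum, h_sum, sum_powerset_coverWeight n _ _ h_pos (by omega), h_card,
    show n - (B.card - A.card) = n - B.card + A.card by omega,
    ← one_div_mul_choose_eq_coverWeight h_pos (by omega)]
  have : (A.card : ℝ) ≠ 0 := by positivity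
  field_simp

/-- Every maximal chain enters a nontrivial upper set exactly once. -/
theorem sum_upperSet_boundary_coverWeight {n : ℕ} (U : Finset (Finset (Fin n)))
    (h_up : ∀ X ∈ U, ∀ Y, X ⊆ Y → Y ∈ U) (h_empty : ∅ ∉ U) (h_univ : univ ∈ U) :
    ∑ X ∈ U, ((X.filter fun x => X.erase x ∉ U).card : ℝ) * coverWeight n X.card = 1 := by
  have h_out : ∀ X ∈ U, ((X.filter fun x => X.erase x ∉ U).card : ℝ) * coverWeight n X.card
      = X.card * coverWeight n X.card
        - ∑ x ∈ X.filter (fun x => X.erase x ∈ U), coverWeight n X.card := by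
    intro X _
    rw [sum_const, nsmul_eq_mul, ← card_filter_add_card_filter_not (s := X)
      (fun x => X.erase x ∈ U)]
    push_cast
    ring
  have h_in : ∑ X ∈ U, ∑ x ∈ X.filter (fun x => X.erase x ∈ U), coverWeight n X.card
      = ∑ Y ∈ U, ∑ y ∈ Yᶜ, coverWeight n (Y.card + 1) := by
    rw [sum_sigma', sum_sigma']
    refine sum_bij' (fun p _ => ⟨p.1.erase p.2, p.2⟩) (fun p _ => ⟨insert p.2 p.1, p.2⟩)
      ?_ ?_ ?_ ?_ ?_
    · rintro ⟨X, x⟩ h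
      simp_all
    · rintro ⟨Y, y⟩ h
      simp only [mem_sigma, mem_compl] at h
      simp [erase_insert h.2, h.1, h_up Y h.1 _ (subset_insert y Y)]
    · rintro ⟨X, x⟩ h
      simp only [mem_sigma, mem_filter] at h
      simp [insert_erase h.2.1]
    · rintro ⟨Y, y⟩ h
      simp only [mem_sigma, mem_compl] at h
      simp [erase_insert h.2]
    · rintro ⟨X, x⟩ h
      simp only [mem_sigma, mem_filter] at h
      simp [card_erase_add_one h.2.1]
  rw [sum_congr rfl h_out, sum_sub_distrib, h_in, ← sum_sub_distrib,
    sum_eq_single_of_mem univ h_univ]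
  · have h_n : 0 < n := by
      rcases Nat.eq_zero_or_pos n with rfl | h
      · exact absurd (by simpa using h_univ) h_empty
      · exact h
    have : (n : ℝ) ≠ 0 := by positivity
    simp [← one_div_mul_choose_eq_coverWeight h_n le_rfl, this]
  · intro X hX hX_univ
    have h_pos : 0 < X.card := by
      refine card_pos.2 (nonempty_iff_ne_empty.2 ?_)
      rintro rfl
      exact h_empty hX
    have h_lt : X.card < n := by
      simpa using card_lt_univ_of_notMem (s := X) (x := _)
        (by simpa [eq_univ_iff_forall] using hX_univ : ∃ x, x ∉ X).choose_spec
    rw [sum_const, nsmul_eq_mul, card_compl, Fintype.card_fin,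
      card_mul_coverWeight_eq h_pos h_lt, sub_self]

theorem mem_upSet {n : ℕ} {F : Finset (Finset (Fin n))} {X : Finset (Fin n)} :
    X ∈ upSet n F ↔ ∃ A ∈ F, A ⊆ X := by
  simp [upSet]

theorem mem_downSet {n : ℕ} {F : Finset (Finset (Fin n))} {X : Finset (Fin n)} :
    X ∈ downSet n F ↔ ∃ A ∈ F, X ⊆ A := by
  simp [downSet]

theorem mem_zSet {n : ℕ} {F : Finset (Finset (Fin n))} {X : Finset (Fin n)} (hX : X ∈ upSet n F)
    {x : Fin n} : x ∈ zSet n F X ↔ ∀ A ∈ F, A ⊆ X → x ∈ A := by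
  simp [zSet, hX, mem_inf]

theorem zSet_eq_filter_erase_notMem {n : ℕ} {F : Finset (Finset (Fin n))} {X : Finset (Fin n)}
    (hX : X ∈ upSet n F) : zSet n F X = X.filter fun x => X.erase x ∉ upSet n F := by
  ext x
  rw [mem_zSet hX, mem_filter, mem_upSet]
  push Not
  constructor
  · intro h
    obtain ⟨A, hA, hAX⟩ := mem_upSet.1 hX
    exact ⟨hAX (h A hA hAX), fun A hA hAX => notMem_erase x X
      (hAX (h A hA (hAX.trans (erase_subset _ _))))⟩
  · rintro ⟨-, h⟩ A hA hAX
    by_contra hxA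
    exact h A hA (subset_erase.2 ⟨hAX, hxA⟩)

/-- The Ahlswede–Cai identity for two set systems. -/
theorem ahlswede_cai_identity (n q : ℕ) (hq : 0 < q)
    (A B : Fin q → Finset (Fin n))
    (hA : ∀ i, A i ≠ ∅)
    (hAB : ∀ j k, A j ⊆ B k ↔ j = k) :
    ∑ i, (1 : ℝ) / (Nat.choose (n - (B i).card + (A i).card) (A i).card)
      + ∑ X ∈ upSet n (Finset.univ.image A) \ downSet n (Finset.univ.image B),
          ((zSet n (Finset.univ.image A) X).card : ℝ) / (X.card * (Nat.choose n X.card))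
      = 1 := by
  set U := upSet n (univ.image A) with hU
  have h_mem : ∀ X, X ∈ U ↔ ∃ i, A i ⊆ X := fun X => by simp [hU, mem_upSet]
  have h_empty : ∅ ∉ U := by simpa [h_mem] using hA
  have h_total := sum_upperSet_boundary_coverWeight U
    (fun X hX Y hXY => (h_mem Y).2 (((h_mem X).1 hX).imp fun _ h => h.trans hXY))
    h_empty ((h_mem _).2 ⟨⟨0, hq⟩, subset_univ _⟩)
  have h_boundary : ∀ X ∈ U, ((X.filter fun x => X.erase x ∉ U).card : ℝ)
      * coverWeight n X.card
      = ((zSet n (univ.image A) X).card : ℝ) * coverWeight n X.card := fun X hX => by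
    rw [zSet_eq_filter_erase_notMem hX]
  rw [sum_congr rfl h_boundary,
    ← sum_inter_add_sum_sdiff U (downSet n (univ.image B))] at h_total
  refine Eq.trans ?_ h_total
  congr 1
  · have h_inter : U ∩ downSet n (univ.image B) = univ.biUnion fun i => Icc (A i) (B i) := by
      ext X
      simp only [mem_inter, h_mem, mem_downSet, mem_image, mem_univ, true_and,
        exists_exists_eq_and, mem_biUnion, mem_Icc]
      constructor
      · rintro ⟨⟨i, hi⟩, j, hj⟩
        obtain rfl := (hAB i j).1 (hi.trans hj)
        exact ⟨i, hi, hj⟩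
      · rintro ⟨i, hi, hj⟩
        exact ⟨⟨i, hi⟩, i, hj⟩
    rw [h_inter, sum_biUnion]
    · refine sum_congr rfl fun i _ => ?_
      rw [← sum_Icc_card_mul_coverWeight (nonempty_iff_ne_empty.2 (hA i)) ((hAB i i).2 rfl)]
      refine sum_congr rfl fun X hX => ?_
      obtain ⟨hAX, hXB⟩ := mem_Icc.1 hX
      have h_z : zSet n (univ.image A) X = A i := by
        ext x
        rw [mem_zSet ((h_mem X).2 ⟨i, hAX⟩)]
        constructor
        · intro h
          exact h _ (mem_image_of_mem A (mem_univ i)) hAX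
        · intro hx C hC hCX
          obtain ⟨j, -, rfl⟩ := mem_image.1 hC
          rwa [(hAB j i).1 (hCX.trans hXB)]
      rw [h_z]
    · intro i _ j _ hij
      refine disjoint_left.2 fun X hXi hXj => hij ?_
      exact (hAB i j).1 ((mem_Icc.1 hXi).1.trans (mem_Icc.1 hXj).2)
  · refine sum_congr rfl fun X hX => ?_
    have h_pos : 0 < X.card := by
      refine card_pos.2 (nonempty_iff_ne_empty.2 ?_)
      rintro rfl
      exact h_empty (mem_sdiff.1 hX).1
    rw [← one_div_mul_choose_eq_coverWeight h_pos (by simpa using card_le_univ X), mul_one_div]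
end

section
/- Let a, m be real numbers, n a natural number, and l a natural number with l < n. If ak + m ≠ 0 for all integers k with l ≤ k ≤ n, then g_{a,m}(n, l) + g_{a,m}(n, l+1) = g_{a,m}(n−1, l). -/
open Finset

/-- The recurrence g_{a,m}(n,l) + g_{a,m}(n,l+1) = g_{a,m}(n-1,l). -/
theorem g_recurrence (a m : ℝ) (n l : ℕ) (hln : l < n)
    (hk : ∀ k : ℕ, l ≤ k → k ≤ n → a * k + m ≠ 0) :
    g a m n l + g a m n (l + 1) = g a m (n - 1) l := by
  obtain ⟨e, rfl⟩ : ∃ e, n = l + e + 1 := ⟨n - l - 1, by omega⟩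
  have hx : a * l + m ≠ 0 := hk l le_rfl (by omega)
  have hy : a * ((l + e + 1 : ℕ) : ℝ) + m ≠ 0 := hk _ (by omega) le_rfl
  have hQ : ∏ k ∈ Finset.Icc (l + 1) (l + e), (a * (k : ℝ) + m) ≠ 0 := by
    refine Finset.prod_ne_zero_iff.mpr fun k hmem => ?_
    rw [Finset.mem_Icc] at hmem
    exact hk k (by omega) (by omega)
  have hfirst : ∏ k ∈ Finset.Icc l (l + e), (a * (k : ℝ) + m) =
      (a * l + m) * ∏ k ∈ Finset.Icc (l + 1) (l + e), (a * (k : ℝ) + m) := by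
    rw [← Finset.insert_Icc_add_one_left_eq_Icc (by omega : l ≤ l + e),
      Finset.prod_insert (by simp)]
  unfold g
  rw [show l + e + 1 - l = e + 1 by omega, show l + e + 1 - (l + 1) = e by omega,
    show l + e + 1 - 1 = l + e by omega, show l + e - l = e by omega,
    Finset.prod_Icc_succ_top (by omega : l ≤ l + e + 1),
    Finset.prod_Icc_succ_top (by omega : l + 1 ≤ l + e + 1), hfirst, Nat.factorial_succ]
  generalize ∏ k ∈ Finset.Icc (l + 1) (l + e), (a * (k : ℝ) + m) = Q at hQ ⊢
  push_cast at hy ⊢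
  field_simp
  ring
end

section
/- Let A and B be nonempty families of subsets of [n] = {1,...,n} with ∅ ∉ A and ∅ ∉ B, and let A ∨ B = {A ∪ B : A ∈ A, B ∈ B}. Then for every nonempty X ⊆ [n], |Z_{A ∪ B}(X)| = |Z_A(X)| + |Z_B(X)| − |Z_{A ∨ B}(X)|. -/
open Finset

theorem mem_zSet_iff {n : ℕ} {F : Finset (Finset (Fin n))} {X : Finset (Fin n)} {x : Fin n} :
    x ∈ zSet n F X ↔ (∃ A ∈ F, A ⊆ X) ∧ ∀ A ∈ F, A ⊆ X → x ∈ A := by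
  by_cases h : ∃ A ∈ F, A ⊆ X <;> simp [zSet, upSet, h, Finset.mem_inf]

theorem zSet_eq_empty {n : ℕ} {F : Finset (Finset (Fin n))} {X : Finset (Fin n)}
    (h : ¬ ∃ A ∈ F, A ⊆ X) : zSet n F X = ∅ := by
  simp [zSet, upSet, h]

theorem zSet_union_of_not_exists {n : ℕ} {F G : Finset (Finset (Fin n))} {X : Finset (Fin n)}
    (h : ¬ ∃ A ∈ F, A ⊆ X) : zSet n (F ∪ G) X = zSet n G X := by
  ext x
  simp only [mem_zSet_iff, mem_union]
  grind

theorem exists_mem_joinFam_subset {n : ℕ} {F G : Finset (Finset (Fin n))} {X : Finset (Fin n)} :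
    (∃ C ∈ joinFam n F G, C ⊆ X) ↔ (∃ A ∈ F, A ⊆ X) ∧ ∃ B ∈ G, B ⊆ X := by
  simp only [joinFam, mem_image, mem_product, Prod.exists]
  constructor
  · rintro ⟨_, ⟨A, B, ⟨hA, hB⟩, rfl⟩, h⟩
    exact ⟨⟨A, hA, subset_union_left.trans h⟩, B, hB, subset_union_right.trans h⟩
  · rintro ⟨⟨A, hA, hAX⟩, B, hB, hBX⟩
    exact ⟨A ∪ B, ⟨A, B, ⟨hA, hB⟩, rfl⟩, union_subset hAX hBX⟩

theorem zSet_union_eq_inter {n : ℕ} {F G : Finset (Finset (Fin n))} {X : Finset (Fin n)}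
    (hF : ∃ A ∈ F, A ⊆ X) (hG : ∃ B ∈ G, B ⊆ X) :
    zSet n (F ∪ G) X = zSet n F X ∩ zSet n G X := by
  ext x
  simp only [mem_zSet_iff, mem_union, mem_inter]
  grind

theorem zSet_joinFam_eq_union {n : ℕ} {F G : Finset (Finset (Fin n))} {X : Finset (Fin n)}
    (hF : ∃ A ∈ F, A ⊆ X) (hG : ∃ B ∈ G, B ⊆ X) :
    zSet n (joinFam n F G) X = zSet n F X ∪ zSet n G X := by
  ext x
  simp only [mem_union, mem_zSet_iff, exists_mem_joinFam_subset, hF, hG, true_and]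
  constructor
  · intro h
    by_contra! hx
    obtain ⟨⟨A, hA, hAX, hxA⟩, B, hB, hBX, hxB⟩ := hx
    have hmem : A ∪ B ∈ joinFam n F G :=
      mem_image.2 ⟨(A, B), mem_product.2 ⟨hA, hB⟩, rfl⟩
    exact (mem_union.1 (h _ hmem (union_subset hAX hBX))).elim hxA hxB
  · rintro h C hC hCX
    obtain ⟨⟨A, B⟩, hp, rfl⟩ := mem_image.1 hC
    obtain ⟨hA, hB⟩ := mem_product.1 hp
    exact mem_union.2 (h.imp (fun h => h A hA (subset_union_left.trans hCX))
      (fun h => h B hB (subset_union_right.trans hCX)))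

/-- |Z_{A∪B}(X)| = |Z_A(X)| + |Z_B(X)| − |Z_{A∨B}(X)| for nonempty X. -/
theorem card_zSet_union (n : ℕ) (A B : Finset (Finset (Fin n)))
    (hA : A.Nonempty) (hB : B.Nonempty)
    (hAne : ∅ ∉ A) (hBne : ∅ ∉ B)
    (X : Finset (Fin n)) (hX : X.Nonempty) :
    ((zSet n (A ∪ B) X).card : ℤ)
      = (zSet n A X).card + (zSet n B X).card - (zSet n (joinFam n A B) X).card := by
  by_cases hF : ∃ C ∈ A, C ⊆ X
  · by_cases hG : ∃ C ∈ B, C ⊆ X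
    · rw [zSet_union_eq_inter hF hG, zSet_joinFam_eq_union hF hG]
      have := card_union_add_card_inter (zSet n A X) (zSet n B X)
      lia
    · have hJ : ¬ ∃ C ∈ joinFam n A B, C ⊆ X := fun h => hG (exists_mem_joinFam_subset.1 h).2
      simp [union_comm A B, zSet_union_of_not_exists hG, zSet_eq_empty hG, zSet_eq_empty hJ]
  · have hJ : ¬ ∃ C ∈ joinFam n A B, C ⊆ X := fun h => hF (exists_mem_joinFam_subset.1 h).1
    simp [zSet_union_of_not_exists hF, zSet_eq_empty hF, zSet_eq_empty hJ]
end

section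
/- Let a, m be real numbers and A_1, A_2, B_1, B_2 families of subsets of [n] = {1,...,n} with ∅ ∉ A_1 ∪ A_2 ∪ B_1 ∪ B_2, each of A_1, A_2, B_1, B_2 nonempty, and U_n(A_1) ∩ D_n(B_2) = ∅ = U_n(A_2) ∩ D_n(B_1). Set A = A_1 ∪ A_2 and B = B_1 ∪ B_2. If F is a function on subsets of [n] that is nonzero on U_n(A), then ∑_{X ∈ U_n(A) \ D_n(B)} (a·|Z_A(X)| + m)/F(X) = ∑_{X ∈ U_n(A_1) \ D_n(B_1)} (a·|Z_{A_1}(X)| + m)/F(X) + ∑_{X ∈ U_n(A_2) \ D_n(B_2)} (a·|Z_{A_2}(X)| + m)/F(X) − ∑_{X ∈ U_n(A_1 ∨ A_2)} (a·|Z_{A_1 ∨ A_2}(X)| + m)/F(X). -/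
open Finset

theorem upSet_union (n : ℕ) (F G : Finset (Finset (Fin n))) :
    upSet n (F ∪ G) = upSet n F ∪ upSet n G := by
  ext X
  simp only [mem_upSet, mem_union, or_and_right, exists_or]

theorem downSet_union (n : ℕ) (F G : Finset (Finset (Fin n))) :
    downSet n (F ∪ G) = downSet n F ∪ downSet n G := by
  ext X
  simp only [downSet, mem_filter, mem_univ, true_and, mem_union, or_and_right, exists_or]

theorem upSet_joinFam (n : ℕ) (F G : Finset (Finset (Fin n))) :
    upSet n (joinFam n F G) = upSet n F ∩ upSet n G := by
  ext X
  simp only [mem_upSet, joinFam, mem_image, mem_product, mem_inter, Prod.exists]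
  constructor
  · rintro ⟨_, ⟨A, B, ⟨hA, hB⟩, rfl⟩, h⟩
    exact ⟨⟨A, hA, subset_union_left.trans h⟩, ⟨B, hB, subset_union_right.trans h⟩⟩
  · rintro ⟨⟨A, hA, hAX⟩, ⟨B, hB, hBX⟩⟩
    exact ⟨A ∪ B, ⟨A, B, ⟨hA, hB⟩, rfl⟩, union_subset hAX hBX⟩

theorem zSet_union {n : ℕ} {F G : Finset (Finset (Fin n))} {X : Finset (Fin n)}
    (hF : X ∈ upSet n F) (hG : X ∈ upSet n G) :
    zSet n (F ∪ G) X = zSet n F X ∩ zSet n G X := by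
  have h : X ∈ upSet n (F ∪ G) := by
    rw [upSet_union]
    exact mem_union_left _ hF
  ext x
  simp only [mem_zSet h, mem_inter, mem_zSet hF, mem_zSet hG, mem_union, or_imp, forall_and]

theorem zSet_union_of_notMem_right {n : ℕ} {F G : Finset (Finset (Fin n))} {X : Finset (Fin n)}
    (hG : X ∉ upSet n G) : zSet n (F ∪ G) X = zSet n F X := by
  have hG' : G.filter (fun A => A ⊆ X) = ∅ := by
    rw [filter_eq_empty_iff]
    exact fun A hA hAX => hG (mem_upSet.2 ⟨A, hA, hAX⟩)
  simp only [zSet, upSet_union, mem_union, hG, or_false, filter_union, hG', union_empty]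

theorem zSet_joinFam {n : ℕ} {F G : Finset (Finset (Fin n))} {X : Finset (Fin n)}
    (hF : X ∈ upSet n F) (hG : X ∈ upSet n G) :
    zSet n (joinFam n F G) X = zSet n F X ∪ zSet n G X := by
  have h : X ∈ upSet n (joinFam n F G) := by
    rw [upSet_joinFam]
    exact mem_inter.2 ⟨hF, hG⟩
  ext x
  rw [mem_zSet h, mem_union, mem_zSet hF, mem_zSet hG]
  simp only [joinFam, mem_image, mem_product, Prod.exists]
  constructor
  · intro hx
    by_contra! hc
    obtain ⟨⟨A, hA, hAX, hxA⟩, ⟨B, hB, hBX, hxB⟩⟩ := hc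
    have := hx (A ∪ B) ⟨A, B, ⟨hA, hB⟩, rfl⟩ (union_subset hAX hBX)
    exact (mem_union.1 this).elim hxA hxB
  · rintro hx _ ⟨A, B, ⟨hA, hB⟩, rfl⟩ hX
    exact mem_union.2 (hx.imp (fun h => h A hA (subset_union_left.trans hX))
      (fun h => h B hB (subset_union_right.trans hX)))

/-- Summation decomposition lemma for two pairs of set systems. -/
theorem sum_decomposition (a m : ℝ) (n : ℕ)
    (A1 A2 B1 B2 : Finset (Finset (Fin n)))
    (hA1 : A1.Nonempty) (hA2 : A2.Nonempty) (hB1 : B1.Nonempty) (hB2 : B2.Nonempty)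
    (hne : ∅ ∉ A1 ∪ A2 ∪ B1 ∪ B2)
    (hd1 : upSet n A1 ∩ downSet n B2 = ∅)
    (hd2 : upSet n A2 ∩ downSet n B1 = ∅)
    (F : Finset (Fin n) → ℝ)
    (hF : ∀ X ∈ upSet n (A1 ∪ A2), F X ≠ 0) :
    ∑ X ∈ upSet n (A1 ∪ A2) \ downSet n (B1 ∪ B2),
        (a * (zSet n (A1 ∪ A2) X).card + m) / F X
      = ∑ X ∈ upSet n A1 \ downSet n B1, (a * (zSet n A1 X).card + m) / F X
        + ∑ X ∈ upSet n A2 \ downSet n B2, (a * (zSet n A2 X).card + m) / F X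
        - ∑ X ∈ upSet n (joinFam n A1 A2), (a * (zSet n (joinFam n A1 A2) X).card + m) / F X := by
  have disj1 : ∀ X ∈ upSet n A1, X ∉ downSet n B2 := fun X hU hD => by
    simpa [hd1] using mem_inter.2 ⟨hU, hD⟩
  have disj2 : ∀ X ∈ upSet n A2, X ∉ downSet n B1 := fun X hU hD => by
    simpa [hd2] using mem_inter.2 ⟨hU, hD⟩
  have sum_eq : ∀ (S : Finset (Finset (Fin n))) (f : Finset (Fin n) → ℝ),
      ∑ X ∈ S, f X = ∑ X, if X ∈ S then f X else 0 := fun S f => by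
    rw [sum_ite_mem, univ_inter]
  rw [sum_eq (upSet n (A1 ∪ A2) \ _), sum_eq (upSet n A1 \ _), sum_eq (upSet n A2 \ _),
    sum_eq (upSet n (joinFam n A1 A2)), ← sum_add_distrib, ← sum_sub_distrib]
  refine sum_congr rfl fun X _ => ?_
  simp only [mem_sdiff, upSet_union, downSet_union, upSet_joinFam, mem_union, mem_inter]
  by_cases h1 : X ∈ upSet n A1 <;> by_cases h2 : X ∈ upSet n A2
  · have hcard : (((zSet n A1 X ∪ zSet n A2 X).card : ℝ)) + (zSet n A1 X ∩ zSet n A2 X).card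
        = (zSet n A1 X).card + (zSet n A2 X).card :=
      mod_cast card_union_add_card_inter (zSet n A1 X) (zSet n A2 X)
    simp only [h1, h2, disj1 X h1, disj2 X h2, zSet_union h1 h2, zSet_joinFam h1 h2, or_self,
      and_self, not_false_eq_true, if_true]
    rw [← add_div, ← sub_div]
    congr 1
    linear_combination a * hcard
  · simp [h1, h2, disj1 X h1, zSet_union_of_notMem_right h2]
  · simp [h1, h2, disj2 X h2, union_comm A1 A2, zSet_union_of_notMem_right h1]
  · simp [h1, h2]
end

section
/- Let A_1, A_2, B_1, B_2 be nonempty families of subsets of [n] = {1,...,n} with ∅ ∉ A_1 ∪ A_2 ∪ B_1 ∪ B_2 and U_n(A_1) ∩ D_n(B_2) = ∅ = U_n(A_2) ∩ D_n(B_1). Set A = A_1 ∪ A_2 and B = B_1 ∪ B_2. Then U_n(A) \ D_n(B) equals the union of the three sets (U_n(A_1) \ (D_n(B_1) ∪ U_n(A_2))), (U_n(A_2) \ (D_n(B_2) ∪ U_n(A_1))), and U_n(A_1 ∨ A_2). -/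
open Finset

/-- Set decomposition: U_n(A) \ D_n(B) is the union of three sets. -/
theorem upset_sdiff_downset_decomposition (n : ℕ)
    (A1 A2 B1 B2 : Finset (Finset (Fin n)))
    (hA1 : A1.Nonempty) (hA2 : A2.Nonempty) (hB1 : B1.Nonempty) (hB2 : B2.Nonempty)
    (hne : ∅ ∉ A1 ∪ A2 ∪ B1 ∪ B2)
    (hd1 : upSet n A1 ∩ downSet n B2 = ∅)
    (hd2 : upSet n A2 ∩ downSet n B1 = ∅) :
    upSet n (A1 ∪ A2) \ downSet n (B1 ∪ B2)
      = (upSet n A1 \ (downSet n B1 ∪ upSet n A2))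
        ∪ (upSet n A2 \ (downSet n B2 ∪ upSet n A1))
        ∪ upSet n (joinFam n A1 A2) := by
  rw [upSet_union, downSet_union, upSet_joinFam]
  ext X
  have h1 : X ∈ upSet n A1 → X ∉ downSet n B2 := fun h h' =>
    disjoint_left.1 (disjoint_iff_inter_eq_empty.2 hd1) h h'
  have h2 : X ∈ upSet n A2 → X ∉ downSet n B1 := fun h h' =>
    disjoint_left.1 (disjoint_iff_inter_eq_empty.2 hd2) h h'
  clear hd1 hd2
  simp only [mem_union, mem_sdiff, mem_inter]
  by_cases hX1 : X ∈ upSet n A1 <;> by_cases hX2 : X ∈ upSet n A2 <;> simp_all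
end

section
/- Let a, m be real numbers, n a natural number, and A, B nonempty subsets of [n] = {1,...,n} with A ⊆ B. If ak + m ≠ 0 for all integers k with |A| ≤ k ≤ n, then ∑_{X : A ⊆ X ⊆ B} g_{a,m}(n, |X|) = g_{a,m}(n − |B| + |A|, |A|), where the sum runs over all sets X with A ⊆ X ⊆ B. -/
open Finset

theorem g_add_g_succ (a m : ℝ) {n l : ℕ} (hl : l ≤ n)
    (hk : ∀ k : ℕ, l ≤ k → k ≤ n + 1 → a * k + m ≠ 0) :
    g a m (n + 1) l + g a m (n + 1) (l + 1) = g a m n l := by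
  have hfirst : ∏ k ∈ Icc l (n + 1), (a * (k : ℝ) + m)
      = (a * l + m) * ∏ k ∈ Icc (l + 1) (n + 1), (a * (k : ℝ) + m) := by
    rw [← Finset.insert_Icc_add_one_left_eq_Icc (by lia : l ≤ n + 1), prod_insert (by simp)]
  have hlast : ∏ k ∈ Icc l (n + 1), (a * (k : ℝ) + m)
      = (∏ k ∈ Icc l n, (a * (k : ℝ) + m)) * (a * ((n + 1 : ℕ) : ℝ) + m) :=
    prod_Icc_succ_top (by lia) _
  have hl_ne := hk l le_rfl (by lia)
  have hn_ne := hk (n + 1) (by lia) le_rfl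
  have htail_ne : ∏ k ∈ Icc (l + 1) (n + 1), (a * (k : ℝ) + m) ≠ 0 :=
    prod_ne_zero_iff.2 fun k hkm => by
      rw [mem_Icc] at hkm
      exact hk k (by lia) hkm.2
  have hinit_ne : ∏ k ∈ Icc l n, (a * (k : ℝ) + m) ≠ 0 :=
    prod_ne_zero_iff.2 fun k hkm => by
      rw [mem_Icc] at hkm
      exact hk k hkm.1 (by lia)
  have hprod := hfirst.symm.trans hlast
  obtain ⟨d, rfl⟩ := Nat.exists_eq_add_of_le hl
  unfold g
  rw [hfirst, show l + d + 1 - l = d + 1 by lia, show l + d + 1 - (l + 1) = d by lia,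
    show l + d - l = d by lia, Nat.factorial_succ]
  generalize ∏ k ∈ Icc (l + 1) (l + d + 1), (a * (k : ℝ) + m) = P at *
  generalize ∏ k ∈ Icc l (l + d), (a * (k : ℝ) + m) = Q at *
  push_cast at hprod ⊢
  field_simp
  linear_combination -a ^ d * hprod

theorem sum_powerset_g {α : Type*} [DecidableEq α] (a m : ℝ) (l : ℕ) (S : Finset α) (n : ℕ)
    (hn : l + S.card ≤ n) (hk : ∀ k : ℕ, l ≤ k → k ≤ n → a * k + m ≠ 0) :
    ∑ Y ∈ S.powerset, g a m n (l + Y.card) = g a m (n - S.card) l := by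
  induction S using Finset.induction_on generalizing n with
  | empty => simp
  | insert x S hx ih =>
    rw [card_insert_of_notMem hx] at hn ⊢
    obtain ⟨n, rfl⟩ : ∃ p, n = p + 1 := ⟨n - 1, by lia⟩
    rw [sum_powerset_insert hx, ← sum_add_distrib, Nat.add_sub_add_right,
      ← ih n (by lia) fun k h₁ h₂ => hk k h₁ (by lia)]
    refine sum_congr rfl fun Y hY => ?_
    rw [mem_powerset] at hY
    have hcard := card_le_card hY
    rw [card_insert_of_notMem fun h => hx (hY h), ← add_assoc]
    exact g_add_g_succ a m (by lia) fun k h₁ h₂ => hk k (by lia) h₂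

/-- ∑_{A ⊆ X ⊆ B} g_{a,m}(n,|X|) = g_{a,m}(n − |B| + |A|, |A|). -/
theorem sum_g_interval (a m : ℝ) (n : ℕ) (A B : Finset (Fin n))
    (hA : A.Nonempty) (hB : B.Nonempty) (hAB : A ⊆ B)
    (hk : ∀ k : ℕ, A.card ≤ k → k ≤ n → a * k + m ≠ 0) :
    ∑ X ∈ Finset.Icc A B, g a m n X.card = g a m (n - B.card + A.card) A.card := by
  have hcard := card_sdiff_add_card_eq_card hAB
  have hBn : B.card ≤ n := by simpa using card_le_univ B
  have hdisj : ∀ Y ∈ (B \ A).powerset, Disjoint A Y := fun Y hY =>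
    disjoint_sdiff.mono_right (mem_powerset.1 hY)
  rw [Icc_eq_image_powerset hAB, sum_image, show n - B.card + A.card = n - (B \ A).card by lia,
    ← sum_powerset_g a m A.card (B \ A) n (by lia) hk]
  · exact sum_congr rfl fun Y hY => by rw [card_union_of_disjoint (hdisj Y hY)]
  · intro Y hY Z hZ h
    rw [← union_sdiff_cancel_left (hdisj Y hY), ← union_sdiff_cancel_left (hdisj Z hZ)]
    exact congrArg (· \ A) h
end

section
/- Let a, m be real numbers, n a natural number, and A a single-element family {A} where ∅ ≠ A ⊆ [n] = {1,...,n}. If ak + m ≠ 0 for all integers k with |A| ≤ k ≤ n, then ∑_{X : A ⊆ X ⊆ [n]} (a·|A| + m) · g_{a,m}(n, |X|) = 1. -/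
open Finset

theorem g_self (a m : ℝ) (n : ℕ) : g a m n n = 1 / (a * n + m) := by
  simp [g]

theorem g_succ_left (a m : ℝ) {n l : ℕ} (h : l ≤ n) :
    g a m (n + 1) l = ((n + 1 - l : ℕ) : ℝ) * a / (a * (n + 1 : ℕ) + m) * g a m n l := by
  simp only [g]
  rw [← Finset.insert_Icc_right_eq_Icc_add_one (by omega : l ≤ n + 1),
    Finset.prod_insert (by simp), Nat.succ_sub h, Nat.factorial_succ, pow_succ, div_mul_div_comm]
  push_cast
  ring

theorem sum_choose_mul_g (a m : ℝ) (l d : ℕ)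
    (h : ∀ k : ℕ, l ≤ k → k ≤ l + d → a * k + m ≠ 0) :
    ∑ j ∈ range (d + 1), (d.choose j : ℝ) * g a m (l + d) (l + j) = 1 / (a * l + m) := by
  induction d with
  | zero => simp [g_self]
  | succ d ih =>
    have hl := h l le_rfl (by omega)
    have hn := h (l + d + 1) (by omega) (by omega)
    have hstep : ∀ j ∈ range (d + 1), ((d + 1).choose j : ℝ) * g a m (l + (d + 1)) (l + j) =
        (d + 1) * a / (a * (l + d + 1 : ℕ) + m) * ((d.choose j : ℝ) * g a m (l + d) (l + j)) := by
      intro j hj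
      have hj' : j ≤ d := Nat.lt_succ_iff.mp (mem_range.mp hj)
      have hc : (d.choose j : ℝ) * (d + 1) = (d + 1).choose j * (d + 1 - j : ℕ) := by
        exact_mod_cast Nat.choose_mul_succ_eq d j
      rw [← add_assoc, g_succ_left a m (by omega : l + j ≤ l + d),
        show l + d + 1 - (l + j) = d + 1 - j by omega]
      linear_combination -(a / (a * (l + d + 1 : ℕ) + m) * g a m (l + d) (l + j)) * hc
    rw [sum_range_succ, sum_congr rfl hstep, ← mul_sum,
      ih fun k hk hk' => h k hk (by omega), Nat.choose_self, g_self, ← add_assoc]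
    field_simp
    push_cast
    ring

/-- A sum over the supersets of `A`, grouped by cardinality. -/
theorem sum_superset_apply_card {α M : Type*} [Fintype α] [DecidableEq α] [AddCommMonoid M]
    (A : Finset α) (f : ℕ → M) :
    ∑ X ∈ univ.filter (fun X => A ⊆ X), f X.card =
      ∑ j ∈ range (Aᶜ.card + 1), Aᶜ.card.choose j • f (A.card + j) := by
  rw [← sum_powerset_apply_card (fun j => f (A.card + j))]
  symm
  refine sum_bij' (fun Y _ => A ∪ Y) (fun X _ => X \ A) ?_ ?_ ?_ ?_ ?_
  · simp
  · intro X _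
    rw [mem_powerset, sdiff_eq_inter_compl]
    exact inter_subset_right
  · intro Y hY
    rw [mem_powerset, subset_compl_iff_disjoint_left] at hY
    exact union_sdiff_cancel_left hY
  · intro X hX
    exact union_sdiff_of_subset (mem_filter.mp hX).2
  · intro Y hY
    rw [mem_powerset, subset_compl_iff_disjoint_left] at hY
    rw [card_union_of_disjoint hY]

/-- Case of a single-element family: ∑_{A ⊆ X ⊆ [n]} (a|A| + m)·g_{a,m}(n,|X|) = 1. -/
theorem singleton_generalized_az (a m : ℝ) (n : ℕ) (A : Finset (Fin n))
    (hA : A ≠ ∅)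
    (hk : ∀ k : ℕ, A.card ≤ k → k ≤ n → a * k + m ≠ 0) :
    ∑ X ∈ Finset.univ.filter (fun X => A ⊆ X),
      (a * A.card + m) * g a m n X.card = 1 := by
  have hle : A.card ≤ n := by simpa using card_le_univ A
  have hd : A.card + (n - A.card) = n := Nat.add_sub_cancel' hle
  have hsum := sum_choose_mul_g a m A.card (n - A.card) (by rwa [hd])
  rw [hd] at hsum
  rw [← mul_sum, sum_superset_apply_card, card_compl, Fintype.card_fin]
  simp only [nsmul_eq_mul]
  rw [hsum, mul_one_div_cancel (hk _ le_rfl hle)]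
end
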